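/- arXiv:1011.3594 — 2 statements merged into one kernel-verified Lean document; each statement's English description precedes it below -/
import Mathlib

section
/- The product-form distribution π is a stationary distribution of the CSMA/CA Markov chain: for every valid state w′, Σ_{w valid} π(w)·Q(w, w′) = π(w′). -/
open scoped BigOperators Classical

/-- A CSMA/CA state: on-off vector `x`, total transmission lengths `b`,
remaining times `a` (with the convention `b k = a k = 0` for inactive links). -/
structure CState (K : ℕ) where
  x : Fin K → Bool
  b : Fin K → ℕ
  a : Fin K → ℕ

variable {K : ℕ}

/-- The set of active links forming singleton components of the induced subgraph,
i.e. active links with no active neighbour. -/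
noncomputable def Sset (G : SimpleGraph (Fin K)) (x : Fin K → Bool) : Finset (Fin K) :=
  Finset.univ.filter (fun k => x k = true ∧ ∀ j, x j = true → ¬ G.Adj k j)

/-- The set of active links lying in components of size `> 1`,
i.e. active links with at least one active neighbour. -/
noncomputable def Zset (G : SimpleGraph (Fin K)) (x : Fin K → Bool) : Finset (Fin K) :=
  Finset.univ.filter (fun k => x k = true ∧ ∃ j, x j = true ∧ G.Adj k j)

/-- The number of connected components of the induced subgraph `G(x)` of size `> 1`. -/
noncomputable def hnum (G : SimpleGraph (Fin K)) (x : Fin K → Bool) : ℕ :=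
  Nat.card {c : (G.induce {k | x k = true}).ConnectedComponent // 1 < Nat.card c.supp}

/-- A valid CSMA/CA state. -/
def ValidState (G : SimpleGraph (Fin K)) (P : Fin K → ℕ → ℝ) (γ : ℕ) (w : CState K) : Prop :=
  (∀ k, w.x k = false → w.b k = 0 ∧ w.a k = 0) ∧
  (∀ k, w.x k = true → 1 ≤ w.a k ∧ w.a k ≤ w.b k) ∧
  (∀ k ∈ Sset G w.x, 0 < P k (w.b k)) ∧
  (∀ k ∈ Zset G w.x, w.b k = γ) ∧
  (∀ k ∈ Zset G w.x, ∀ j ∈ Zset G w.x, ∀ (hk : w.x k = true) (hj : w.x j = true),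
     (G.induce {i | w.x i = true}).Reachable ⟨k, hk⟩ ⟨j, hj⟩ → w.a k = w.a j)

/-- `f(b, j, x)`: equal to `1` for colliding links and `P j b` for successful links. -/
noncomputable def fwt (G : SimpleGraph (Fin K)) (P : Fin K → ℕ → ℝ) (b : ℕ) (j : Fin K)
    (x : Fin K → Bool) : ℝ :=
  if j ∈ Zset G x then 1 else P j b

/-- The unnormalized weight `π₀(w)`. -/
noncomputable def pi0 (G : SimpleGraph (Fin K)) (P : Fin K → ℕ → ℝ) (p : Fin K → ℝ)
    (w : CState K) : ℝ :=
  (∏ i ∈ Finset.univ.filter (fun i => w.x i = false), (1 - p i)) *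
    ∏ j ∈ Finset.univ.filter (fun j => w.x j = true), (p j * fwt G P (w.b j) j w.x)

/-- `A₁(w)`: active links whose remaining time exceeds `1`. -/
noncomputable def A1 (w : CState K) : Finset (Fin K) :=
  Finset.univ.filter (fun k => w.x k = true ∧ 1 < w.a k)

/-- `Ā₁(w) = A₁(w) ∪ ∂A₁(w)`. -/
noncomputable def A1bar (G : SimpleGraph (Fin K)) (w : CState K) : Finset (Fin K) :=
  A1 w ∪ Finset.univ.filter (fun j => w.x j = false ∧ ∃ k ∈ A1 w, G.Adj j k)

/-- `A₂(w)`: the complement of `Ā₁(w)`. -/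
noncomputable def A2 (G : SimpleGraph (Fin K)) (w : CState K) : Finset (Fin K) :=
  Finset.univ \ A1bar G w

/-- Admissibility of the ordered pair of states `(w, w')`. -/
def Admissible (G : SimpleGraph (Fin K)) (γ : ℕ) (w w' : CState K) : Prop :=
  (∀ k ∈ A1bar G w, w'.x k = w.x k) ∧
  (∀ k ∈ A1bar G w, w.x k = true → w'.b k = w.b k ∧ w'.a k = w.a k - 1) ∧
  (∀ k ∈ A2 G w, w'.x k = true → w'.a k = w'.b k) ∧
  (∀ k ∈ A2 G w, k ∈ Zset G w'.x → w'.b k = γ)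

/-- The transition probability `Q(w, w')` of the CSMA/CA Markov chain. -/
noncomputable def Qmat (G : SimpleGraph (Fin K)) (P : Fin K → ℕ → ℝ) (p : Fin K → ℝ) (γ : ℕ)
    (w w' : CState K) : ℝ :=
  if Admissible G γ w w' then
    ∏ i ∈ A2 G w, (if w'.x i then p i * fwt G P (w'.b i) i w'.x else 1 - p i)
  else 0

/-- The time-reversed transition probability `Q̃(w', w)`. -/
noncomputable def Qtil (G : SimpleGraph (Fin K)) (P : Fin K → ℕ → ℝ) (p : Fin K → ℝ) (γ : ℕ)
    (w' w : CState K) : ℝ :=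
  if Admissible G γ w w' then
    ∏ i ∈ A2 G w, (if w.x i then p i * fwt G P (w.b i) i w.x else 1 - p i)
  else 0

/-- The reversal map `g`. -/
def revState (w : CState K) : CState K :=
  ⟨w.x, w.b, fun k => if w.x k then w.b k - w.a k + 1 else 0⟩

lemma mem_Zset (G : SimpleGraph (Fin K)) (x : Fin K → Bool) (k : Fin K) :
    k ∈ Zset G x ↔ x k = true ∧ ∃ j, x j = true ∧ G.Adj k j := by
  simp [Zset]

lemma mem_Sset (G : SimpleGraph (Fin K)) (x : Fin K → Bool) (k : Fin K) :
    k ∈ Sset G x ↔ x k = true ∧ k ∉ Zset G x := by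
  simp only [Sset, Zset, Finset.mem_filter, Finset.mem_univ, true_and]
  constructor
  · rintro ⟨h1, h2⟩
    exact ⟨h1, fun ⟨_, j, hj, hadj⟩ => h2 j hj hadj⟩
  · rintro ⟨h1, h2⟩
    exact ⟨h1, fun j hj hadj => h2 ⟨h1, j, hj, hadj⟩⟩

lemma mem_A1 (w : CState K) (k : Fin K) : k ∈ A1 w ↔ w.x k = true ∧ 1 < w.a k := by
  simp [A1]

lemma mem_A2 (G : SimpleGraph (Fin K)) (w : CState K) (k : Fin K) :
    k ∈ A2 G w ↔ k ∉ A1bar G w := by simp [A2]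

lemma mem_A1bar (G : SimpleGraph (Fin K)) (w : CState K) (k : Fin K) :
    k ∈ A1bar G w ↔ k ∈ A1 w ∨ (w.x k = false ∧ ∃ j ∈ A1 w, G.Adj k j) := by
  simp [A1bar]

lemma valid_adj {G : SimpleGraph (Fin K)} {P : Fin K → ℕ → ℝ} {γ : ℕ} {w : CState K}
    (h : ValidState G P γ w) {k j : Fin K} (hk : w.x k = true) (hj : w.x j = true)
    (hadj : G.Adj k j) : w.a k = w.a j ∧ w.b k = γ ∧ w.b j = γ := by
  obtain ⟨-, -, -, h4, h5⟩ := h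
  have hkz : k ∈ Zset G w.x := (mem_Zset _ _ _).2 ⟨hk, j, hj, hadj⟩
  have hjz : j ∈ Zset G w.x := (mem_Zset _ _ _).2 ⟨hj, k, hk, hadj.symm⟩
  refine ⟨h5 k hkz j hjz hk hj ?_, h4 k hkz, h4 j hjz⟩
  apply SimpleGraph.Adj.reachable
  simpa using hadj

lemma reach_of_adj {G : SimpleGraph (Fin K)} {w : CState K}
    (h : ∀ k j, w.x k = true → w.x j = true → G.Adj k j → w.a k = w.a j)
    (u v : {i // i ∈ {i | w.x i = true}})
    (hr : (G.induce {i | w.x i = true}).Reachable u v) : w.a u.1 = w.a v.1 := by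
  obtain ⟨p⟩ := hr
  induction p with
  | nil => rfl
  | cons hadj _ ih =>
    rename_i u v _ _
    exact (h u.1 v.1 u.2 v.2 (by simpa using hadj)).trans ih

/-- Per-link weight. -/
noncomputable def wt (G : SimpleGraph (Fin K)) (P : Fin K → ℕ → ℝ) (p : Fin K → ℝ)
    (w : CState K) (i : Fin K) : ℝ :=
  if w.x i then p i * fwt G P (w.b i) i w.x else 1 - p i

lemma pi0_eq (G : SimpleGraph (Fin K)) (P : Fin K → ℕ → ℝ) (p : Fin K → ℝ)
    (w : CState K) : pi0 G P p w = ∏ i, wt G P p w i := by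
  unfold pi0 wt
  rw [Finset.prod_ite, mul_comm]
  simp

/-- Links that were already transmitting in the previous slot. -/
noncomputable def Bs (w : CState K) : Finset (Fin K) :=
  Finset.univ.filter (fun k => w.x k = true ∧ w.a k < w.b k)

/-- Links refreshed in the last step. -/
noncomputable def Cs (G : SimpleGraph (Fin K)) (w : CState K) : Finset (Fin K) :=
  Finset.univ.filter (fun k => k ∉ Bs w ∧ ¬ (w.x k = false ∧ ∃ j ∈ Bs w, G.Adj k j))

lemma mem_Bs (w : CState K) (k : Fin K) : k ∈ Bs w ↔ w.x k = true ∧ w.a k < w.b k := by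
  simp [Bs]

lemma not_mem_Cs (G : SimpleGraph (Fin K)) (w : CState K) (k : Fin K) :
    k ∉ Cs G w ↔ k ∈ Bs w ∨ (w.x k = false ∧ ∃ j ∈ Bs w, G.Adj k j) := by
  simp only [Cs, Finset.mem_filter, Finset.mem_univ, true_and]
  rw [not_and_or, not_not, not_not]

lemma Cs_not_adj {G : SimpleGraph (Fin K)} {P : Fin K → ℕ → ℝ} {γ : ℕ} {w : CState K}
    (h : ValidState G P γ w) {k j : Fin K} (hj : j ∈ Bs w) (hadj : G.Adj k j) :
    k ∉ Cs G w := by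
  rw [not_mem_Cs]
  cases hx : w.x k with
  | false => exact Or.inr ⟨rfl, j, hj, hadj⟩
  | true =>
    left
    rw [mem_Bs] at hj ⊢
    have := valid_adj h hx hj.1 hadj
    refine ⟨hx, ?_⟩
    omega

lemma A1_eq {G : SimpleGraph (Fin K)} {P : Fin K → ℕ → ℝ} {γ : ℕ} {w w' : CState K}
    (h : ValidState G P γ w) (ha : Admissible G γ w w') :
    A1 w = Bs w' := by
  obtain ⟨a1, a2, a3, a4⟩ := ha
  ext k
  rw [mem_A1, mem_Bs]
  constructor
  · rintro ⟨hx, hk⟩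
    have hm : k ∈ A1bar G w := (mem_A1bar _ _ _).2 (Or.inl ((mem_A1 _ _).2 ⟨hx, hk⟩))
    have := a2 k hm hx
    have := h.2.1 k hx
    exact ⟨(a1 k hm).trans hx, by omega⟩
  · rintro ⟨hx, hk⟩
    by_cases hm : k ∈ A1bar G w
    · rcases (mem_A1bar _ _ _).1 hm with h1 | h1
      · exact (mem_A1 _ _).1 h1
      · have := a1 k hm
        simp_all
    · have := a3 k ((mem_A2 _ _ _).2 hm) hx
      omega

lemma A2_eq {G : SimpleGraph (Fin K)} {P : Fin K → ℕ → ℝ} {γ : ℕ} {w w' : CState K}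
    (h : ValidState G P γ w) (ha : Admissible G γ w w') :
    A2 G w = Cs G w' := by
  have hA := A1_eq h ha
  ext k
  rw [mem_A2, ← not_iff_not, not_not, not_mem_Cs, mem_A1bar, hA]
  refine or_congr Iff.rfl ⟨?_, ?_⟩
  · rintro ⟨hx, j, hj, hadj⟩
    refine ⟨?_, j, hj, hadj⟩
    rw [ha.1 k ((mem_A1bar _ _ _).2 (Or.inr ⟨hx, j, hA ▸ hj, hadj⟩)), hx]
  · rintro ⟨hx, j, hj, hadj⟩
    refine ⟨?_, j, hj, hadj⟩
    by_contra hc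
    have hc : w.x k = true := by simpa using hc
    rw [← hA, mem_A1] at hj
    have := (valid_adj h hc hj.1 hadj).1
    have hk : k ∈ A1 w := (mem_A1 _ _).2 ⟨hc, by omega⟩
    rw [hA, mem_Bs] at hk
    simp_all

/-- Reconstruct a predecessor from the on-off vector and lengths. -/
noncomputable def phi (G : SimpleGraph (Fin K)) (w' : CState K)
    (xb : (Fin K → Bool) × (Fin K → ℕ)) : CState K :=
  ⟨xb.1, xb.2, fun i => if xb.1 i then (if i ∈ Cs G w' then 1 else w'.a i + 1) else 0⟩

/-- weight of the choice on the refreshed links -/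
noncomputable def hw (G : SimpleGraph (Fin K)) (P : Fin K → ℕ → ℝ) (p : Fin K → ℝ) (γ : ℕ)
    (C : Finset (Fin K)) (x : Fin K → Bool) (i : Fin K) (b : ℕ) : ℝ :=
  if i ∈ C then
    (if x i then (if i ∈ Zset G x then p i * (if b = γ then 1 else 0) else p i * P i b)
      else (1 - p i) * (if b = 0 then 1 else 0))
  else 1

noncomputable def Xset (C : Finset (Fin K)) (x' : Fin K → Bool) : Finset (Fin K → Bool) :=
  Fintype.piFinset (fun i => if i ∈ C then Finset.univ else {x' i})

noncomputable def Bset (C : Finset (Fin K)) (b' : Fin K → ℕ) (N : ℕ) : Finset (Fin K → ℕ) :=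
  Fintype.piFinset (fun i => if i ∈ C then Finset.range N else {b' i})

lemma mem_Xset (C : Finset (Fin K)) (x' x : Fin K → Bool) :
    x ∈ Xset C x' ↔ ∀ i, i ∉ C → x i = x' i := by
  simp only [Xset, Fintype.mem_piFinset]
  refine forall_congr' fun i => ?_
  split_ifs with h <;> simp [h]

lemma mem_Bset (C : Finset (Fin K)) (b' b : Fin K → ℕ) (N : ℕ) :
    b ∈ Bset C b' N ↔ ∀ i, (i ∉ C → b i = b' i) ∧ (i ∈ C → b i < N) := by
  simp only [Bset, Fintype.mem_piFinset]
  refine forall_congr' fun i => ?_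
  split_ifs with h <;> simp [h]

lemma hw_sum (G : SimpleGraph (Fin K)) (P : Fin K → ℕ → ℝ) (p : Fin K → ℝ) (γ : ℕ)
    (C : Finset (Fin K)) (x' : Fin K → Bool) (b' : Fin K → ℕ) (N : ℕ) (hN : γ < N)
    (hPs : ∀ k, ∑ b ∈ Finset.range N, P k b = 1) :
    ∑ xb ∈ Xset C x' ×ˢ Bset C b' N, ∏ i, hw G P p γ C xb.1 i (xb.2 i) = 1 := by
  rw [Finset.sum_product]
  have h1 : ∀ x : Fin K → Bool, ∑ b ∈ Bset C b' N, ∏ i, hw G P p γ C x i (b i)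
      = ∏ i, (if i ∈ C then (if x i then p i else 1 - p i) else 1) := by
    intro x
    unfold Bset
    rw [← Finset.prod_univ_sum]
    refine Finset.prod_congr rfl fun i _ => ?_
    unfold hw
    by_cases hi : i ∈ C
    · simp only [hi, if_true]
      cases x i
      · have : 0 < N := by omega
        simp [← Finset.mul_sum, this]
      · by_cases hz : i ∈ Zset G x
        · simp [hz, ← Finset.mul_sum, hN]
        · simp [hz, ← Finset.mul_sum, hPs]
    · simp [hi]
  simp only [h1]
  unfold Xset
  rw [← Finset.prod_univ_sum (fun i => if i ∈ C then Finset.univ else {x' i})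
    (fun i (t : Bool) => if i ∈ C then (if t then p i else 1 - p i) else (1 : ℝ))]
  apply Finset.prod_eq_one
  intro i _
  by_cases hi : i ∈ C <;> simp [hi]

section main
variable {G : SimpleGraph (Fin K)} {P : Fin K → ℕ → ℝ} {p : Fin K → ℝ} {γ N : ℕ} {w' : CState K}

lemma phi_of_adm (hw' : ValidState G P γ w') (hN : γ < N) (hPb : ∀ k b, N ≤ b → P k b = 0)
    {w : CState K} (h : ValidState G P γ w) (ha : Admissible G γ w w') :
    ∃ xb ∈ Xset (Cs G w') w'.x ×ˢ Bset (Cs G w') w'.b N, phi G w' xb = w := by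
  have hA1 := A1_eq h ha
  have hA2 := A2_eq h ha
  have hbar : ∀ k, k ∉ Cs G w' → k ∈ A1bar G w := by
    intro k hk
    by_contra hc
    exact hk (hA2 ▸ (mem_A2 _ _ _).2 hc)
  refine ⟨(w.x, w.b), ?_, ?_⟩
  · rw [Finset.mem_product, mem_Xset, mem_Bset]
    refine ⟨fun i hi => (ha.1 i (hbar i hi)).symm, fun i => ⟨fun hi => ?_, fun hi => ?_⟩⟩
    · cases hx : w.x i
      · have hx' := ha.1 i (hbar i hi)
        rw [hx] at hx'
        simp [(h.1 i hx).1, (hw'.1 i hx').1]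
      · exact (ha.2.1 i (hbar i hi) hx).1.symm
    · cases hx : w.x i
      · simp only [(h.1 i hx).1]; omega
      · by_cases hz : i ∈ Zset G w.x
        · simp only [h.2.2.2.1 i hz]; exact hN
        · have := h.2.2.1 i ((mem_Sset _ _ _).2 ⟨hx, hz⟩)
          by_contra hc
          rw [hPb i _ (by simpa using hc)] at this
          exact lt_irrefl _ this
  · obtain ⟨x, b, a⟩ := w
    simp only [phi, CState.mk.injEq, true_and]
    funext i
    rcases Bool.eq_false_or_eq_true (x i) with hx | hx
    rotate_left
    · simpa [hx] using (h.1 i hx).2.symm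
    · have h1 := h.2.1 i hx
      by_cases hi : i ∈ Cs G w'
      · have : i ∉ A1 (⟨x, b, a⟩ : CState K) := fun hc =>
          (mem_A2 _ _ _).1 (hA2 ▸ hi) ((mem_A1bar _ _ _).2 (Or.inl hc))
        rw [mem_A1] at this
        simp only [hx, true_and] at this h1
        simp [hx, hi]; omega
      · have := (ha.2.1 i (hbar i hi) hx).2
        simp only [hi] at this h1 ⊢
        simp [hx]; omega

lemma phi_A1 (hw' : ValidState G P γ w') {xb : (Fin K → Bool) × (Fin K → ℕ)}
    (hx : ∀ i, i ∉ Cs G w' → xb.1 i = w'.x i) : A1 (phi G w' xb) = Bs w' := by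
  ext k
  rw [mem_A1]
  constructor
  · rintro ⟨h1, h2⟩
    simp only [phi] at h1 h2
    by_cases hk : k ∈ Cs G w'
    · simp [hk, h1] at h2
    · have := hx k hk
      rcases (not_mem_Cs _ _ _).1 hk with h | h
      · exact h
      · simp_all
  · intro hk
    have hc : k ∉ Cs G w' := (not_mem_Cs _ _ _).2 (Or.inl hk)
    have h1 := hx k hc
    rw [((mem_Bs _ _).1 hk).1] at h1
    have := hw'.2.1 k ((mem_Bs _ _).1 hk).1
    simp only [phi, h1, hc]
    simp; omega

lemma phi_A2 (hw' : ValidState G P γ w') {xb : (Fin K → Bool) × (Fin K → ℕ)}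
    (hx : ∀ i, i ∉ Cs G w' → xb.1 i = w'.x i) : A2 G (phi G w' xb) = Cs G w' := by
  ext k
  rw [mem_A2, ← not_iff_not, not_not, mem_A1bar, phi_A1 hw' hx]
  constructor
  · rintro (h | ⟨_, j, hj, hadj⟩)
    · exact (not_mem_Cs _ _ _).2 (Or.inl h)
    · exact Cs_not_adj hw' hj hadj
  · intro h
    rcases (not_mem_Cs _ _ _).1 h with h1 | ⟨h1, h2⟩
    · exact Or.inl h1
    · exact Or.inr ⟨(hx k h).trans h1, h2⟩

lemma phi_adm (hw' : ValidState G P γ w') {xb : (Fin K → Bool) × (Fin K → ℕ)}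
    (hx : ∀ i, i ∉ Cs G w' → xb.1 i = w'.x i) (hb : ∀ i, i ∉ Cs G w' → xb.2 i = w'.b i) :
    Admissible G γ (phi G w' xb) w' := by
  have hA2 := phi_A2 hw' hx
  have hbar : ∀ k, k ∈ A1bar G (phi G w' xb) → k ∉ Cs G w' := by
    intro k hk hc
    rw [← hA2, mem_A2] at hc
    exact hc hk
  refine ⟨fun k hk => (hx k (hbar k hk)).symm, fun k hk hxk => ⟨(hb k (hbar k hk)).symm, ?_⟩,
    fun k hk hxk => ?_, fun k _ hz => hw'.2.2.2.1 k hz⟩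
  · have := hbar k hk
    simp only [phi] at hxk
    simp [phi, hxk, this]
  · rw [hA2] at hk
    have h1 : k ∉ Bs w' := fun hc => (not_mem_Cs _ _ _).2 (Or.inl hc) hk
    rw [mem_Bs] at h1
    have := hw'.2.1 k hxk
    simp only [hxk, true_and] at h1
    omega

lemma Z_iff (hw' : ValidState G P γ w') {x : Fin K → Bool}
    (hx : ∀ i, i ∉ Cs G w' → x i = w'.x i) {i : Fin K} (hi : i ∈ Bs w') :
    i ∈ Zset G x ↔ i ∈ Zset G w'.x := by
  rw [mem_Zset, mem_Zset, hx i ((not_mem_Cs _ _ _).2 (Or.inl hi))]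
  refine and_congr Iff.rfl (exists_congr fun j => ?_)
  constructor
  · rintro ⟨h1, h2⟩
    exact ⟨(hx j (Cs_not_adj hw' hi h2.symm)) ▸ h1, h2⟩
  · rintro ⟨h1, h2⟩
    exact ⟨(hx j (Cs_not_adj hw' hi h2.symm)).trans h1, h2⟩

lemma wt_eq (hw' : ValidState G P γ w') {xb : (Fin K → Bool) × (Fin K → ℕ)}
    (hx : ∀ i, i ∉ Cs G w' → xb.1 i = w'.x i) (hb : ∀ i, i ∉ Cs G w' → xb.2 i = w'.b i)
    {i : Fin K} (hi : i ∉ Cs G w') : wt G P p (phi G w' xb) i = wt G P p w' i := by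
  unfold wt fwt
  simp only [phi, hx i hi, hb i hi]
  rcases (not_mem_Cs _ _ _).1 hi with h | h
  · simp only [Z_iff hw' hx h]
  · simp [h.1]

lemma phi_valid (hγ : 1 ≤ γ) (hP0 : ∀ k, P k 0 = 0) (hPnn : ∀ k b, 0 ≤ P k b)
    (hw' : ValidState G P γ w') {xb : (Fin K → Bool) × (Fin K → ℕ)}
    (hx : ∀ i, i ∉ Cs G w' → xb.1 i = w'.x i) (hb : ∀ i, i ∉ Cs G w' → xb.2 i = w'.b i)
    (hne : ∏ i, hw G P p γ (Cs G w') xb.1 i (xb.2 i) ≠ 0) :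
    ValidState G P γ (phi G w' xb) := by
  obtain ⟨x, b⟩ := xb
  simp only at hx hb hne
  have hne' : ∀ i, hw G P p γ (Cs G w') x i (b i) ≠ 0 := fun i =>
    Finset.prod_ne_zero_iff.1 hne i (Finset.mem_univ i)
  have hBs : ∀ i, i ∉ Cs G w' → x i = true → i ∈ Bs w' := by
    intro i hi hxi
    rcases (not_mem_Cs _ _ _).1 hi with h | h
    · exact h
    · have := hx i hi
      simp_all
  have hZ : ∀ k ∈ Zset G x, b k = γ := by
    intro k hk
    have hxk := ((mem_Zset _ _ _).1 hk).1
    by_cases hc : k ∈ Cs G w'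
    · have h1 := hne' k
      by_contra hcon
      apply h1
      simp [hw, hc, hxk, hk, hcon]
    · rw [hb k hc]
      exact hw'.2.2.2.1 k ((Z_iff hw' hx (hBs k hc hxk)).1 hk)
  have hS : ∀ k ∈ Sset G x, 0 < P k (b k) := by
    intro k hk
    obtain ⟨hxk, hz⟩ := (mem_Sset _ _ _).1 hk
    by_cases hc : k ∈ Cs G w'
    · refine lt_of_le_of_ne (hPnn _ _) fun h0 => hne' k ?_
      simp [hw, hc, hxk, hz, ← h0]
    · rw [hb k hc]
      refine hw'.2.2.1 k ((mem_Sset _ _ _).2 ⟨(hx k hc) ▸ hxk, fun h => hz ?_⟩)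
      exact (Z_iff hw' hx (hBs k hc hxk)).2 h
  refine ⟨fun k hk => ?_, fun k hk => ?_, hS, hZ, ?_⟩
  · simp only [phi] at hk ⊢
    simp only [hk]
    refine ⟨?_, by simp⟩
    by_cases hc : k ∈ Cs G w'
    · by_contra hcon
      apply hne' k
      simp [hw, hc, hk, hcon]
    · rw [hb k hc]
      exact (hw'.1 k ((hx k hc) ▸ hk)).1
  · simp only [phi] at hk ⊢
    simp only [hk, if_true]
    by_cases hc : k ∈ Cs G w'
    · simp only [hc, if_true, le_refl, true_and]
      by_cases hz : k ∈ Zset G x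
      · rw [hZ k hz]; exact hγ
      · have := hS k ((mem_Sset _ _ _).2 ⟨hk, hz⟩)
        by_contra hcon
        have h0 : b k = 0 := by omega
        rw [h0, hP0] at this
        exact lt_irrefl _ this
    · have := (mem_Bs _ _).1 (hBs k hc hk)
      simp only [hc, hb k hc, if_false]
      omega
  · intro k _ j _ hk hj hr
    refine reach_of_adj ?_ _ _ hr
    intro k j hk hj hadj
    simp only [phi] at hk hj ⊢
    simp only [hk, hj, if_true]
    by_cases hc : k ∈ Cs G w'
    · have hc' : j ∈ Cs G w' := by
        by_contra hcj
        exact Cs_not_adj hw' (hBs j hcj hj) hadj hc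
      simp [hc, hc']
    · have hcj := Cs_not_adj hw' (hBs k hc hk) hadj.symm
      simp only [hc, hcj, if_false]
      rw [(valid_adj hw' ((hx k hc) ▸ hk) ((hx j hcj) ▸ hj) hadj).1]

lemma term_eq (hw' : ValidState G P γ w') {xb : (Fin K → Bool) × (Fin K → ℕ)}
    (hx : ∀ i, i ∉ Cs G w' → xb.1 i = w'.x i) (hb : ∀ i, i ∉ Cs G w' → xb.2 i = w'.b i)
    (hv : ValidState G P γ (phi G w' xb)) :
    pi0 G P p (phi G w' xb) * Qmat G P p γ (phi G w' xb) w' =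
      pi0 G P p w' * ∏ i, hw G P p γ (Cs G w') xb.1 i (xb.2 i) := by
  rw [Qmat, if_pos (phi_adm hw' hx hb), phi_A2 hw' hx, pi0_eq, pi0_eq]
  change _ * ∏ i ∈ Cs G w', wt G P p w' i = _
  have e1 : ∏ i, hw G P p γ (Cs G w') xb.1 i (xb.2 i)
      = ∏ i ∈ Cs G w', wt G P p (phi G w' xb) i := by
    rw [← Finset.prod_subset (Finset.subset_univ (Cs G w'))]
    · refine Finset.prod_congr rfl fun i hi => ?_
      unfold hw wt fwt
      simp only [hi, if_true, phi]
      by_cases hxi : xb.1 i = true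
      · by_cases hz : i ∈ Zset G xb.1
        · have : xb.2 i = γ := hv.2.2.2.1 i hz
          simp [hxi, hz, this]
        · simp [hxi, hz]
      · have : xb.2 i = 0 := (hv.1 i (by simpa [phi] using hxi)).1
        simp [hxi, this]
    · intro i _ hi
      simp [hw, hi]
  rw [e1, ← Finset.prod_mul_prod_compl (Cs G w') (wt G P p (phi G w' xb)),
    ← Finset.prod_mul_prod_compl (Cs G w') (wt G P p w')]
  rw [Finset.prod_congr rfl (fun i hi => wt_eq (p := p) hw' hx hb (Finset.mem_compl.1 hi))]
  ring

end main

/-- the product-form distribution `π = π₀/E` is stationary for the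
CSMA/CA Markov chain: for every valid state `w'`, `Σ_w π(w)·Q(w,w') = π(w')`. -/
theorem stmt1
    (K : ℕ) (hK : 1 ≤ K) (G : SimpleGraph (Fin K))
    (p : Fin K → ℝ) (hp : ∀ i, p i ∈ Set.Ioo (0 : ℝ) 1)
    (γ : ℕ) (hγ : 1 ≤ γ)
    (P : Fin K → ℕ → ℝ) (hP0 : ∀ k, P k 0 = 0) (hPnn : ∀ k b, 0 ≤ P k b)
    (hPsum : ∀ k, ∑' b : ℕ, P k b = 1)
    (hPfin : ∃ bmax : ℕ, 0 < bmax ∧ ∀ k b, bmax < b → P k b = 0)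
    (w' : CState K) (hw' : ValidState G P γ w') :
    (∑' w : {w : CState K // ValidState G P γ w},
        (pi0 G P p w.1 / (∑' v : {v : CState K // ValidState G P γ v}, pi0 G P p v.1)) *
          Qmat G P p γ w.1 w') =
      pi0 G P p w' / (∑' v : {v : CState K // ValidState G P γ v}, pi0 G P p v.1) := by
  obtain ⟨bmax, -, hbm⟩ := hPfin
  set N := max bmax γ + 1 with hNdef
  have hN : γ < N := by omega
  have hPb : ∀ k b, N ≤ b → P k b = 0 := fun k b h => hbm k b (by omega)
  have hPs : ∀ k, ∑ b ∈ Finset.range N, P k b = 1 := by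
    intro k
    rw [← hPsum k]
    exact (tsum_eq_sum fun b hb => hPb k b (by simpa using hb)).symm
  have key : ∑' w : {w : CState K // ValidState G P γ w}, pi0 G P p w.1 * Qmat G P p γ w.1 w'
      = pi0 G P p w' := by
    have h1 := tsum_subtype {w : CState K | ValidState G P γ w}
      (fun w => pi0 G P p w * Qmat G P p γ w w')
    refine Eq.trans h1 ?_
    rw [tsum_eq_sum (s := (Xset (Cs G w') w'.x ×ˢ Bset (Cs G w') w'.b N).image (phi G w'))]
    · rw [Finset.sum_image]
      · rw [← mul_one (pi0 G P p w'), ← hw_sum G P p γ (Cs G w') w'.x w'.b N hN hPs,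
          Finset.mul_sum]
        refine Finset.sum_congr rfl fun xb hxb => ?_
        rw [Finset.mem_product, mem_Xset, mem_Bset] at hxb
        have hx := hxb.1
        have hb := fun i => (hxb.2 i).1
        by_cases hv : ValidState G P γ (phi G w' xb)
        · rw [Set.indicator_of_mem (by exact hv)]
          exact term_eq hw' hx hb hv
        · rw [Set.indicator_of_notMem (by exact hv)]
          by_contra hne
          exact hv (phi_valid hγ hP0 hPnn hw' hx hb fun h0 => hne (by rw [h0, mul_zero]))
      · intro u _ v _ huv
        simp only [phi, CState.mk.injEq] at huv
        exact Prod.ext huv.1 huv.2.1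
    · intro w hw
      by_cases hv : ValidState G P γ w
      · rw [Set.indicator_of_mem (by exact hv)]
        by_cases ha : Admissible G γ w w'
        · obtain ⟨xb, hm, he⟩ := phi_of_adm hw' hN hPb hv ha
          exact absurd (Finset.mem_image.2 ⟨xb, hm, he⟩) hw
        · simp [Qmat, ha]
      · rw [Set.indicator_of_notMem (by exact hv)]
  simp only [div_mul_eq_mul_div]
  rw [tsum_div_const, key]
end

section
/- There exists a constant b > 0 such that for every ε ∈ (0,1) with ε ≤ 1/b, λ̄ᵀ·r*((1−ε)λ̄) ≤ b·[ log(1/ε) + log(N'/b) + 2G* + 1 ]. -/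
open scoped BigOperators Classical

variable {K : ℕ}

/-- `g(x) = γ^{h(x)} ∏ᵢ pᵢ^{xᵢ} qᵢ^{1-xᵢ}`. -/
noncomputable def gON (G : SimpleGraph (Fin K)) (p : Fin K → ℝ) (γ : ℕ)
    (x : Fin K → Bool) : ℝ :=
  (γ : ℝ) ^ hnum G x * ∏ i, (if x i then p i else 1 - p i)

/-- The normalizing constant `E(r)`. -/
noncomputable def Efun (G : SimpleGraph (Fin K)) (p : Fin K → ℝ) (γ : ℕ) (τ T₀ : ℝ)
    (r : Fin K → ℝ) : ℝ :=
  ∑ x : Fin K → Bool, gON G p γ x * ∏ k ∈ Sset G x, (τ + T₀ * Real.exp (r k))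

/-- The stationary probability `p(x; r)` of the on-off state `x`. -/
noncomputable def pON (G : SimpleGraph (Fin K)) (p : Fin K → ℝ) (γ : ℕ) (τ T₀ : ℝ)
    (x : Fin K → Bool) (r : Fin K → ℝ) : ℝ :=
  gON G p γ x * (∏ k ∈ Sset G x, (τ + T₀ * Real.exp (r k))) / Efun G p γ τ T₀ r

/-- The service rate `s_k(r)` of link `k`. -/
noncomputable def sRate (G : SimpleGraph (Fin K)) (p : Fin K → ℝ) (γ : ℕ) (τ T₀ : ℝ)
    (k : Fin K) (r : Fin K → ℝ) : ℝ :=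
  T₀ * Real.exp (r k) / (τ + T₀ * Real.exp (r k)) *
    ∑ x ∈ Finset.univ.filter (fun x : Fin K → Bool => k ∈ Sset G x), pON G p γ τ T₀ x r

/-- `L(r; λ) = Σ_k λ_k r_k − log E(r)`. -/
noncomputable def Lfun (G : SimpleGraph (Fin K)) (p : Fin K → ℝ) (γ : ℕ) (τ T₀ : ℝ)
    (r lam : Fin K → ℝ) : ℝ :=
  (∑ k, lam k * r k) - Real.log (Efun G p γ τ T₀ r)

/-- The indicator vectors of the independent sets of `G`. -/
def indVecs (G : SimpleGraph (Fin K)) : Set (Fin K → ℝ) :=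
  {v | ∃ σ : Fin K → Bool, (∀ i j, σ i = true → σ j = true → ¬ G.Adj i j) ∧
        v = fun i => if σ i then (1 : ℝ) else 0}

/-- `λ` is strictly feasible iff it lies in the interior of the convex hull of the
indicator vectors of the independent sets of `G`. -/
def strictlyFeasible (G : SimpleGraph (Fin K)) (lam : Fin K → ℝ) : Prop :=
  lam ∈ interior (convexHull ℝ (indVecs G))

/-- The finite set `𝒮` of detailed states `(x, z)`. -/
noncomputable def DS (G : SimpleGraph (Fin K)) : Finset ((Fin K → Bool) × (Fin K → Bool)) :=
  Finset.univ.filter (fun s => ∀ k, k ∉ Sset G s.1 → s.2 k = false)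

/-- `g(x, z) = g(x) · (τ')^{|S(x)| − Σ_k z_k} · T₀^{Σ_k z_k}`. -/
noncomputable def gDS (G : SimpleGraph (Fin K)) (p : Fin K → ℝ) (γ : ℕ) (τ T₀ : ℝ)
    (s : (Fin K → Bool) × (Fin K → Bool)) : ℝ :=
  gON G p γ s.1 *
    τ ^ ((Sset G s.1).card - (Finset.univ.filter (fun k => s.2 k = true)).card) *
    T₀ ^ (Finset.univ.filter (fun k => s.2 k = true)).card

/-- The stationary probability `p((x, z); r)` of the detailed state `(x, z)`. -/
noncomputable def pDS (G : SimpleGraph (Fin K)) (p : Fin K → ℝ) (γ : ℕ) (τ T₀ : ℝ)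
    (s : (Fin K → Bool) × (Fin K → Bool)) (r : Fin K → ℝ) : ℝ :=
  gDS G p γ τ T₀ s * Real.exp (∑ k, if s.2 k then r k else 0) / Efun G p γ τ T₀ r

lemma DS_nonempty (G : SimpleGraph (Fin K)) : (DS G).Nonempty :=
  ⟨⟨fun _ => false, fun _ => false⟩,
    Finset.mem_filter.mpr ⟨Finset.mem_univ _, fun _ _ => rfl⟩⟩

/-- `G* = max_{(x,z) ∈ 𝒮} |log g(x, z)|`. -/
noncomputable def Gstar (G : SimpleGraph (Fin K)) (p : Fin K → ℝ) (γ : ℕ) (τ T₀ : ℝ) : ℝ :=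
  (DS G).sup' (DS_nonempty G) (fun s => |Real.log (gDS G p γ τ T₀ s)|)


lemma aux_decomp {ι κ : Type} [Fintype ι] [Fintype κ] (V : ι → κ → ℝ) (lam : κ → ℝ)
    (k0 : κ) (hk0 : 0 < lam k0)
    (hfeas : ∀ π ∈ stdSimplex ℝ ι, ∀ ρ : ℝ, 1 < ρ → ¬ (∀ k, ∑ i, π i * V i k = ρ * lam k))
    (T : Finset ι) :
    ∃ C : ℝ, 0 ≤ C ∧ ∀ (π : ι → ℝ) (e : ℝ), (∀ i, 0 ≤ π i) → (∀ i, i ∉ T → π i = 0) →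
      (∀ k, ∑ i, π i * V i k = (∑ i, π i - e) * lam k) →
      0 ≤ e → 
      ∃ ν : ι → ℝ, (∀ i, 0 ≤ ν i) ∧ (∀ i, ν i ≤ π i) ∧
        (∀ k, ∑ i, ν i * V i k = (∑ i, ν i) * lam k) ∧ ∑ i, π i - ∑ i, ν i ≤ C * e := by
  induction T using Finset.strongInduction with
  | H T ih =>
  by_cases hgood : ∃ μ ∈ stdSimplex ℝ ι, (∀ i, i ∉ T → μ i = 0) ∧
      ∀ k, ∑ i, μ i * V i k = lam k
  · obtain ⟨μ, hμ, hμT, hμm⟩ := hgood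
    have ih' : ∀ s : ι, ∃ C : ℝ, 0 ≤ C ∧ (s ∈ T → ∀ (π : ι → ℝ) (e : ℝ), (∀ i, 0 ≤ π i) →
      (∀ i, i ∉ T.erase s → π i = 0) →
      (∀ k, ∑ i, π i * V i k = (∑ i, π i - e) * lam k) →
      0 ≤ e → 
      ∃ ν : ι → ℝ, (∀ i, 0 ≤ ν i) ∧ (∀ i, ν i ≤ π i) ∧
        (∀ k, ∑ i, ν i * V i k = (∑ i, ν i) * lam k) ∧ ∑ i, π i - ∑ i, ν i ≤ C * e) := by
      intro s
      by_cases hs : s ∈ T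
      · obtain ⟨C, hC, h⟩ := ih (T.erase s) (Finset.erase_ssubset hs)
        exact ⟨C, hC, fun _ => h⟩
      · exact ⟨0, le_rfl, fun h => absurd h hs⟩
    choose C hC hCs using ih'
    refine ⟨∑ s, C s, Finset.sum_nonneg fun s _ => hC s, ?_⟩
    intro π e hπ hπT hm he
    have hne : (Finset.univ.filter fun i => 0 < μ i).Nonempty := by
      by_contra h
      rw [Finset.not_nonempty_iff_eq_empty, Finset.filter_eq_empty_iff] at h
      have h0 : ∑ i, μ i ≤ 0 := Finset.sum_nonpos fun i hi => not_lt.mp (h hi)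
      rw [hμ.2] at h0
      linarith
    obtain ⟨s, hs, hmin⟩ := Finset.exists_min_image _ (fun i => π i / μ i) hne
    have hsμ : 0 < μ s := (Finset.mem_filter.mp hs).2
    have hsT : s ∈ T := by
      by_contra h
      rw [hμT s h] at hsμ
      exact lt_irrefl _ hsμ
    set t := π s / μ s with ht
    have ht0 : 0 ≤ t := div_nonneg (hπ s) hsμ.le
    have hle : ∀ i, t * μ i ≤ π i := by
      intro i
      rcases (hμ.1 i).eq_or_lt with h | h
      · rw [← h, mul_zero]; exact hπ i
      · have := hmin i (Finset.mem_filter.mpr ⟨Finset.mem_univ _, h⟩)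
        exact (le_div_iff₀ h).mp this
    have hs1 : ∑ i, (π i - t * μ i) = ∑ i, π i - t := by
      rw [Finset.sum_sub_distrib, ← Finset.mul_sum, hμ.2, mul_one]
    obtain ⟨ν, hν0, hνle, hνm, hνs⟩ := hCs s hsT (fun i => π i - t * μ i) e
      (fun i => sub_nonneg.mpr (hle i))
      (by
        intro i hi
        by_cases his : i = s
        · subst his
          simp only [ht]
          field_simp
          ring
        · have : i ∉ T := fun h => hi (Finset.mem_erase.mpr ⟨his, h⟩)
          simp [hπT i this, hμT i this])
      (by
        intro k
        rw [hs1]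
        simp only [sub_mul, Finset.sum_sub_distrib, mul_assoc, ← Finset.mul_sum]
        rw [hm k, hμm k]; ring) he
    refine ⟨fun i => ν i + t * μ i, fun i => add_nonneg (hν0 i) (mul_nonneg ht0 (hμ.1 i)),
      fun i => by have := hνle i; simp only at this ⊢; linarith, ?_, ?_⟩
    · intro k
      simp only [add_mul, Finset.sum_add_distrib, mul_assoc, ← Finset.mul_sum]
      rw [hνm k, hμm k, hμ.2]; ring
    · rw [hs1] at hνs
      simp only [Finset.sum_add_distrib, ← Finset.mul_sum]
      rw [hμ.2]
      have : C s * e ≤ (∑ s, C s) * e :=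
        mul_le_mul_of_nonneg_right
          (Finset.single_le_sum (fun i _ => hC i) (Finset.mem_univ s)) he
      linarith
  · -- not good: compactness
    let ef : (ι → ℝ) → ℝ := fun π => 1 - (∑ i, π i * V i k0) / lam k0
    let S : Set (ι → ℝ) := stdSimplex ℝ ι ∩
      ({π | ∀ i, i ∉ T → π i = 0} ∩ {π | ∀ k, ∑ i, π i * V i k = (1 - ef π) * lam k})
    have hef : Continuous ef := by fun_prop
    have hS : IsCompact S := by
      refine (isCompact_stdSimplex ℝ ι).inter_right (IsClosed.inter ?_ ?_)
      · simp only [Set.ofPred_forall]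
        refine isClosed_iInter fun i => isClosed_iInter fun _ => ?_
        exact isClosed_eq (by fun_prop) (by fun_prop)
      · simp only [Set.ofPred_forall]
        refine isClosed_iInter fun i => ?_
        exact isClosed_eq (by fun_prop) (by fun_prop)
    have hpos : ∀ π ∈ S, 0 < ef π := by
      rintro π ⟨h1, h2, h3⟩
      rcases lt_trichotomy (ef π) 0 with h | h | h
      · exact absurd h3 (hfeas π h1 (1 - ef π) (by linarith))
      · refine absurd ⟨π, h1, h2, fun k => ?_⟩ hgood
        rw [h3 k, h]; ring
      · exact h
    have hδ : ∃ δ : ℝ, 0 < δ ∧ ∀ π ∈ S, δ ≤ ef π := by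
      rcases S.eq_empty_or_nonempty with h | h
      · exact ⟨1, one_pos, by simp [h]⟩
      · obtain ⟨π, hπ, hmin⟩ := hS.exists_isMinOn h hef.continuousOn
        exact ⟨ef π, hpos π hπ, fun π' h' => hmin h'⟩
    obtain ⟨δ, hδ0, hδ⟩ := hδ
    refine ⟨1 / δ, by positivity, ?_⟩
    intro π e hπ hπT hm he
    refine ⟨0, fun _ => le_rfl, hπ, by simp, ?_⟩
    simp only [Pi.zero_apply, Finset.sum_const_zero, sub_zero]
    set m := ∑ i, π i with hmdef
    have hm0 : 0 ≤ m := Finset.sum_nonneg fun i _ => hπ i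
    rcases hm0.eq_or_lt with h | h
    · rw [← h]; positivity
    have hval : ∀ k, ∑ i, π i / m * V i k = (1 - e / m) * lam k := by
      intro k
      have : ∑ i, π i / m * V i k = (∑ i, π i * V i k) / m := by
        rw [Finset.sum_div]; exact Finset.sum_congr rfl fun i _ => by ring
      rw [this, hm k]; field_simp
    have hee : ef (fun i => π i / m) = e / m := by
      simp only [ef]
      rw [hval k0]; field_simp; ring
    have hin : (fun i => π i / m) ∈ S := by
      refine ⟨⟨fun i => div_nonneg (hπ i) hm0, ?_⟩, fun i hi => by simp [hπT i hi], ?_⟩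
      · rw [← Finset.sum_div, ← hmdef]; exact div_self h.ne'
      · intro k
        rw [hee]; exact hval k
    have := hδ _ hin
    rw [hee, le_div_iff₀ h] at this
    rw [one_div, inv_mul_eq_div, le_div_iff₀ hδ0]; linarith

lemma aux_main {ι κ : Type} [Fintype ι] [Fintype κ] (V : ι → κ → ℝ) (lam : κ → ℝ)
    (k0 : κ) (hk0 : 0 < lam k0)
    (hfeas : ∀ π ∈ stdSimplex ℝ ι, ∀ ρ : ℝ, 1 < ρ → ¬ (∀ k, ∑ i, π i * V i k = ρ * lam k))
    (hmem : ∃ μ ∈ stdSimplex ℝ ι, ∀ k, ∑ i, μ i * V i k = lam k)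
    (g : ι → ℝ) (hg : ∀ i, 0 < g i) :
    ∃ A C : ℝ, 0 ≤ A ∧ ∀ ε : ℝ, 0 < ε → ε < 1 → ∀ (r : κ → ℝ) (Z : ℝ), 
      Z = ∑ i, g i * Real.exp (∑ k, V i k * r k) →
      (∀ k, ∑ i, (g i * Real.exp (∑ k, V i k * r k) / Z) * V i k = (1 - ε) * lam k) →
      ∑ k, lam k * r k ≤ A * Real.log (1 / ε) + C := by
  obtain ⟨C0, hC0, hdec⟩ := aux_decomp V lam k0 hk0 hfeas Finset.univ
  obtain ⟨μ, hμ, hμm⟩ := hmem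
  set B := ∑ i, |Real.log (g i)| with hB
  have hB0 : 0 ≤ B := Finset.sum_nonneg fun i _ => abs_nonneg _
  have hBi : ∀ i, |Real.log (g i)| ≤ B := fun i =>
    Finset.single_le_sum (f := fun i => |Real.log (g i)|) (fun i _ => abs_nonneg _)
      (Finset.mem_univ i)
  refine ⟨C0, Fintype.card ι + 2 * C0 * B, hC0, ?_⟩
  intro ε hε hε1 r Z hZ hmean
  have hne : Nonempty ι := by
    by_contra h
    rw [not_nonempty_iff] at h
    have := hμ.2
    simp at this
  have hZ0 : 0 < Z := by
    rw [hZ]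
    exact Finset.sum_pos (fun i _ => mul_pos (hg i) (Real.exp_pos _)) Finset.univ_nonempty
  set π : ι → ℝ := fun i => g i * Real.exp (∑ k, V i k * r k) / Z with hπ
  have hπ0 : ∀ i, 0 < π i := fun i => div_pos (mul_pos (hg i) (Real.exp_pos _)) hZ0
  have hπ1 : ∑ i, π i = 1 := by
    simp only [hπ]
    rw [← Finset.sum_div, ← hZ]; exact div_self hZ0.ne'
  have hlog : ∀ i, ∑ k, V i k * r k = Real.log (π i) - Real.log (g i) + Real.log Z := by
    intro i
    simp only [hπ]
    rw [Real.log_div (mul_pos (hg i) (Real.exp_pos _)).ne' hZ0.ne',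
      Real.log_mul (hg i).ne' (Real.exp_pos _).ne', Real.log_exp]
    ring
  obtain ⟨ν, hν0, hνle, hνm, hνs⟩ := hdec π ε (fun i => (hπ0 i).le) (by simp)
    (by intro k; rw [hπ1]; exact hmean k) hε.le
  rw [hπ1] at hνs
  set m := 1 - ∑ i, ν i with hm
  have hm0 : 0 ≤ m := by
    have : ∑ i, ν i ≤ ∑ i, π i := Finset.sum_le_sum fun i _ => hνle i
    rw [hπ1] at this; linarith
  set δ : ι → ℝ := fun i => π i - ν i with hδ
  have hδ0 : ∀ i, 0 ≤ δ i := fun i => sub_nonneg.mpr (hνle i)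
  have hδs : ∑ i, δ i = m := by simp [hδ, Finset.sum_sub_distrib, hπ1, hm]
  have key : ε * ∑ k, lam k * r k = ∑ i, (m * μ i - δ i) * ∑ k, V i k * r k := by
    have h1 : ∑ i, (m * μ i - δ i) * ∑ k, V i k * r k
        = ∑ k, (∑ i, (m * μ i - δ i) * V i k) * r k := by
      simp only [Finset.mul_sum, Finset.sum_mul]
      rw [Finset.sum_comm]
      exact Finset.sum_congr rfl fun i _ => Finset.sum_congr rfl fun j _ => by ring
    rw [h1, Finset.mul_sum]
    refine Finset.sum_congr rfl fun k _ => ?_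
    have h2 : ∑ i, (m * μ i - δ i) * V i k = ε * lam k := by
      simp only [hδ, sub_mul, Finset.sum_sub_distrib, mul_assoc, ← Finset.mul_sum]
      rw [hμm k, hνm k, hmean k, hm]; ring
    rw [h2]; ring
  have hz : ∑ i, (m * μ i - δ i) * Real.log Z = 0 := by
    rw [← Finset.sum_mul, Finset.sum_sub_distrib, ← Finset.mul_sum, hμ.2, hδs]; ring
  have hterm : ∀ i, (m * μ i - δ i) * ∑ k, V i k * r k ≤
      (δ i * Real.log (1 / ε) + ε) + (m * μ i + δ i) * B + (m * μ i - δ i) * Real.log Z := by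
    intro i
    rw [hlog i]
    have hmμ : 0 ≤ m * μ i := mul_nonneg hm0 (hμ.1 i)
    have hπle : π i ≤ 1 := by
      rw [← hπ1]
      exact Finset.single_le_sum (fun i _ => (hπ0 i).le) (Finset.mem_univ i)
    have a1 : m * μ i * Real.log (π i) ≤ 0 :=
      mul_nonpos_of_nonneg_of_nonpos hmμ (Real.log_nonpos (hπ0 i).le hπle)
    have a2 : -(δ i * Real.log (π i)) ≤ δ i * Real.log (1 / ε) + ε := by
      rcases (hδ0 i).eq_or_lt with h | h
      · rw [← h]; simp [hε.le]
      · have hdl : δ i ≤ π i := by have := hν0 i; simp only [hδ]; linarith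
        have b1 : Real.log (δ i) ≤ Real.log (π i) := Real.log_le_log h hdl
        have b2 := Real.log_le_sub_one_of_pos (div_pos hε h)
        rw [Real.log_div hε.ne' h.ne'] at b2
        have b3 : Real.log (1 / ε) = - Real.log ε := by rw [one_div, Real.log_inv]
        rw [b3]
        have b4 : δ i * (Real.log ε - Real.log (π i)) ≤ δ i * (ε / δ i) :=
          mul_le_mul_of_nonneg_left (by linarith) h.le
        rw [mul_div_cancel₀ _ h.ne'] at b4
        linarith
    have a3 : -(m * μ i * Real.log (g i)) ≤ m * μ i * B := by
      have := mul_le_mul_of_nonneg_left ((neg_le_abs _).trans (hBi i)) hmμ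
      linarith
    have a4 : δ i * Real.log (g i) ≤ δ i * B :=
      mul_le_mul_of_nonneg_left ((le_abs_self _).trans (hBi i)) (hδ0 i)
    linarith
  have hsum := Finset.sum_le_sum fun i (_ : i ∈ Finset.univ) => hterm i
  rw [← key, Finset.sum_add_distrib, hz, Finset.sum_add_distrib, Finset.sum_add_distrib,
    ← Finset.sum_mul, ← Finset.sum_mul, Finset.sum_add_distrib, ← Finset.mul_sum, hμ.2, hδs] at hsum
  simp only [Finset.sum_const, Finset.card_univ, nsmul_eq_mul] at hsum
  have hL : 0 ≤ Real.log (1 / ε) := Real.log_nonneg (by rw [le_div_iff₀ hε]; linarith)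
  have c1 := mul_le_mul_of_nonneg_right hνs hL
  have c2 := mul_le_mul_of_nonneg_right hνs hB0
  refine le_of_mul_le_mul_left ?_ hε
  nlinarith

/-- Index type of detailed states: an on-off state together with a subset of its singletons. -/
abbrev DIdx (G : SimpleGraph (Fin K)) : Type :=
  Σ x : Fin K → Bool, {Z : Finset (Fin K) // Z ∈ (Sset G x).powerset}

noncomputable def DVec (G : SimpleGraph (Fin K)) (i : DIdx G) (k : Fin K) : ℝ :=
  if k ∈ i.2.1 then 1 else 0

noncomputable def DWt (G : SimpleGraph (Fin K)) (p : Fin K → ℝ) (γ : ℕ) (τ T₀ : ℝ)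
    (i : DIdx G) : ℝ :=
  gON G p γ i.1 * (T₀ ^ i.2.1.card * τ ^ (Sset G i.1 \ i.2.1).card)

lemma gON_pos (G : SimpleGraph (Fin K)) (p : Fin K → ℝ) (hp : ∀ i, p i ∈ Set.Ioo (0 : ℝ) 1)
    (γ : ℕ) (hγ : 1 ≤ γ) (x : Fin K → Bool) : 0 < gON G p γ x := by
  unfold gON
  have : (0 : ℝ) < γ := by exact_mod_cast hγ
  refine mul_pos (pow_pos this _) (Finset.prod_pos fun i _ => ?_)
  have := hp i
  split_ifs
  · exact this.1
  · exact sub_pos.mpr this.2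

lemma DWt_exp (G : SimpleGraph (Fin K)) (p : Fin K → ℝ) (γ : ℕ) (τ T₀ : ℝ)
    (r : Fin K → ℝ) (i : DIdx G) :
    DWt G p γ τ T₀ i * Real.exp (∑ k, DVec G i k * r k) =
      gON G p γ i.1 * ((∏ j ∈ i.2.1, T₀ * Real.exp (r j)) * ∏ j ∈ Sset G i.1 \ i.2.1, τ) := by
  have h : ∑ k, DVec G i k * r k = ∑ k ∈ i.2.1, r k := by
    simp [DVec, ite_mul, Finset.sum_ite_mem]
  rw [h, Real.exp_sum, DWt, Finset.prod_mul_distrib, Finset.prod_const, Finset.prod_const]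
  ring

lemma sum_DIdx (G : SimpleGraph (Fin K)) (F : (Fin K → Bool) → Finset (Fin K) → ℝ) :
    ∑ i : DIdx G, F i.1 i.2.1 = ∑ x, ∑ Z ∈ (Sset G x).powerset, F x Z := by
  rw [Fintype.sum_sigma]
  exact Finset.sum_congr rfl fun x _ => Finset.sum_coe_sort (Sset G x).powerset (F x)

lemma Efun_eq (G : SimpleGraph (Fin K)) (p : Fin K → ℝ) (γ : ℕ) (τ T₀ : ℝ) (r : Fin K → ℝ) :
    Efun G p γ τ T₀ r =
      ∑ i : DIdx G, DWt G p γ τ T₀ i * Real.exp (∑ k, DVec G i k * r k) := by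
  simp only [DWt_exp]
  rw [sum_DIdx G (fun x Z => gON G p γ x *
    ((∏ j ∈ Z, T₀ * Real.exp (r j)) * ∏ j ∈ Sset G x \ Z, τ)), Efun]
  refine Finset.sum_congr rfl fun x _ => ?_
  rw [← Finset.mul_sum, ← Finset.prod_add]
  simp only [add_comm]

lemma prod_part (S : Finset (Fin K)) (τ : ℝ) (f : Fin K → ℝ) (k : Fin K) (hτ : 0 < τ)
    (hf : ∀ j, 0 < f j) :
    ∑ Z ∈ S.powerset, (if k ∈ Z then ((∏ j ∈ Z, f j) * ∏ j ∈ S \ Z, τ) else 0) =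
      if k ∈ S then f k / (τ + f k) * ∏ j ∈ S, (τ + f j) else 0 := by
  split_ifs with hk
  · have h1 : f k / (τ + f k) * ∏ j ∈ S, (τ + f j)
        = ∏ j ∈ S, (f j + if j = k then 0 else τ) := by
      rw [← Finset.mul_prod_erase S _ hk, ← Finset.mul_prod_erase S _ hk]
      have : τ + f k ≠ 0 := by have := hf k; positivity
      rw [← mul_assoc, div_mul_cancel₀ _ this]
      simp only [if_true, add_zero]
      congr 1
      refine Finset.prod_congr rfl fun j hj => ?_
      rw [if_neg (Finset.ne_of_mem_erase hj), add_comm]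
    rw [h1, Finset.prod_add]
    refine Finset.sum_congr rfl fun Z hZ => ?_
    split_ifs with hkZ
    · congr 1
      refine Finset.prod_congr rfl fun j hj => ?_
      rw [if_neg]
      rintro rfl
      exact (Finset.mem_sdiff.mp hj).2 hkZ
    · symm
      apply mul_eq_zero_of_right
      exact Finset.prod_eq_zero (Finset.mem_sdiff.mpr ⟨hk, hkZ⟩) (if_pos rfl)
  · refine Finset.sum_eq_zero fun Z hZ => if_neg fun h => hk (Finset.mem_powerset.mp hZ h)

lemma sRate_eq (G : SimpleGraph (Fin K)) (p : Fin K → ℝ) (γ : ℕ) (τ T₀ : ℝ)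
    (hτ : 0 < τ) (hT₀ : 0 < T₀) (r : Fin K → ℝ) (k : Fin K) :
    sRate G p γ τ T₀ k r =
      ∑ i : DIdx G, (DWt G p γ τ T₀ i * Real.exp (∑ k, DVec G i k * r k) /
        Efun G p γ τ T₀ r) * DVec G i k := by
  simp only [DWt_exp]
  simp only [DVec]
  rw [sum_DIdx G (fun x Z => gON G p γ x *
    ((∏ j ∈ Z, T₀ * Real.exp (r j)) * ∏ j ∈ Sset G x \ Z, τ) / Efun G p γ τ T₀ r *
      (if k ∈ Z then 1 else 0)), sRate, Finset.sum_filter, Finset.mul_sum]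
  refine Finset.sum_congr rfl fun x _ => ?_
  have h := prod_part (Sset G x) τ (fun j => T₀ * Real.exp (r j)) k hτ
    (fun j => mul_pos hT₀ (Real.exp_pos _))
  have h2 : ∑ Z ∈ (Sset G x).powerset, gON G p γ x *
      ((∏ j ∈ Z, T₀ * Real.exp (r j)) * ∏ j ∈ Sset G x \ Z, τ) / Efun G p γ τ T₀ r *
      (if k ∈ Z then (1 : ℝ) else 0) = gON G p γ x / Efun G p γ τ T₀ r *
      ∑ Z ∈ (Sset G x).powerset,
        (if k ∈ Z then ((∏ j ∈ Z, T₀ * Real.exp (r j)) * ∏ j ∈ Sset G x \ Z, τ) else 0) := by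
    rw [Finset.mul_sum]
    refine Finset.sum_congr rfl fun Z _ => ?_
    split_ifs <;> ring
  rw [h2, h]
  split_ifs
  · rw [pON]; ring
  · simp

lemma DVec_mem (G : SimpleGraph (Fin K)) (i : DIdx G) : DVec G i ∈ indVecs G := by
  refine ⟨fun k => decide (k ∈ i.2.1), ?_, ?_⟩
  · intro a b ha hb
    have ha' := Finset.mem_powerset.mp i.2.2 (of_decide_eq_true ha)
    have hb' := Finset.mem_powerset.mp i.2.2 (of_decide_eq_true hb)
    simp only [Sset, Finset.mem_filter] at ha' hb'
    exact ha'.2.2 b hb'.2.1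
  · funext k
    simp [DVec]

lemma exists_DVec (G : SimpleGraph (Fin K)) (v : Fin K → ℝ) (hv : v ∈ indVecs G) :
    ∃ i : DIdx G, DVec G i = v := by
  obtain ⟨σ, hσ, rfl⟩ := hv
  refine ⟨⟨σ, ⟨Finset.univ.filter fun k => σ k = true, ?_⟩⟩, ?_⟩
  · rw [Finset.mem_powerset]
    intro k hk
    have hk' := (Finset.mem_filter.mp hk).2
    exact Finset.mem_filter.mpr ⟨Finset.mem_univ _, hk', fun j hj => hσ k j hk' hj⟩
  · funext k
    simp [DVec]

lemma exists_mu (G : SimpleGraph (Fin K)) (lam : Fin K → ℝ)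
    (h : lam ∈ convexHull ℝ (indVecs G)) :
    ∃ μ ∈ stdSimplex ℝ (DIdx G), ∀ k, ∑ i, μ i * DVec G i k = lam k := by
  let S : Set (Fin K → ℝ) := {v | ∃ μ ∈ stdSimplex ℝ (DIdx G), ∀ k, ∑ i, μ i * DVec G i k = v k}
  have hS : Convex ℝ S := by
    rintro v ⟨μ, hμ, hv⟩ w ⟨η, hη, hw⟩ a b ha hb hab
    refine ⟨a • μ + b • η, convex_stdSimplex ℝ _ hμ hη ha hb hab, fun k => ?_⟩
    simp only [Pi.add_apply, Pi.smul_apply, smul_eq_mul, add_mul, Finset.sum_add_distrib,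
      mul_assoc, ← Finset.mul_sum, hv k, hw k]
  have hsub : indVecs G ⊆ S := by
    intro v hv
    obtain ⟨i, rfl⟩ := exists_DVec G v hv
    refine ⟨Pi.single i 1, single_mem_stdSimplex ℝ i, fun k => ?_⟩
    simp [Pi.single_apply]
  exact convexHull_min hsub hS h

/-- there is `b > 0` such that for every `ε ∈ (0,1)` with `ε ≤ 1/b`,
`λ̄ᵀ·r*((1−ε)λ̄) ≤ b·[log(1/ε) + log(N'/b) + 2G* + 1]` (stated for any `r` with
`s_k(r) = (1−ε)λ̄_k` for all `k`, i.e. for `r = r*((1−ε)λ̄)`). -/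
theorem stmt12
    (K : ℕ) (hK : 1 ≤ K) (G : SimpleGraph (Fin K))
    (p : Fin K → ℝ) (hp : ∀ i, p i ∈ Set.Ioo (0 : ℝ) 1)
    (γ : ℕ) (hγ : 1 ≤ γ) (τ T₀ : ℝ) (hτ : 0 < τ) (hT₀ : 0 < T₀)
    (lamb : Fin K → ℝ) (hpos : ∀ k, 0 < lamb k)
    (hmem : lamb ∈ convexHull ℝ (indVecs G))
    (hbdry : ∀ ρ : ℝ, 1 < ρ → ρ • lamb ∉ convexHull ℝ (indVecs G))
    : ∃ b : ℝ, 0 < b ∧ ∀ ε : ℝ, 0 < ε → ε < 1 → ε ≤ 1 / b →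
        ∀ r : Fin K → ℝ, (∀ k, sRate G p γ τ T₀ k r = (1 - ε) * lamb k) →
          (∑ k, lamb k * r k) ≤
            b * (Real.log (1 / ε) + Real.log ((DS G).card / b) + 2 * Gstar G p γ τ T₀ + 1) := by

  let k0 : Fin K := ⟨0, hK⟩
  obtain ⟨A, C, hA, hmain⟩ := aux_main (DVec G) lamb k0 (hpos k0)
    (by
      intro π hπ ρ hρ h
      apply hbdry ρ hρ
      have h1 : ∑ i, π i • DVec G i ∈ convexHull ℝ (indVecs G) :=
        (convex_convexHull ℝ _).sum_mem (fun i _ => hπ.1 i) hπ.2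
          (fun i _ => subset_convexHull ℝ _ (DVec_mem G i))
      convert h1 using 1
      funext k
      simp [Finset.sum_apply, h k])
    (exists_mu G lamb hmem) (DWt G p γ τ T₀)
    (fun i => mul_pos (gON_pos G p hp γ hγ _) (mul_pos (pow_pos hT₀ _) (pow_pos hτ _)))
  set c := 2 * (A + 1) with hc
  have hc0 : 0 < c := by positivity
  set b := 2 * (A * |Real.log c| + |C|) + A + 1 with hb
  have hAc : 0 ≤ A * |Real.log c| := mul_nonneg hA (abs_nonneg _)
  have hC0 := abs_nonneg C
  have hb0 : 0 < b := by positivity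
  have hbA : A ≤ b := by linarith
  have hlogb : A * Real.log b + C ≤ b := by
    have h1 := Real.log_le_sub_one_of_pos (div_pos hb0 hc0)
    rw [Real.log_div hb0.ne' hc0.ne'] at h1
    have h2 : A * Real.log b ≤ A * (b / c + |Real.log c|) :=
      mul_le_mul_of_nonneg_left (by linarith [le_abs_self (Real.log c)]) hA
    have h3 : A * (b / c) ≤ b / 2 := by
      rw [hc, ← mul_div_assoc, div_le_div_iff₀ (by positivity) (by positivity)]
      nlinarith
    have h4 := le_abs_self C
    linarith
  refine ⟨b, hb0, ?_⟩
  intro ε hε hε1 hεb r hr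
  have hbound := hmain ε hε hε1 r (Efun G p γ τ T₀ r) (Efun_eq G p γ τ T₀ r)
    (fun k => by rw [← sRate_eq G p γ τ T₀ hτ hT₀ r k]; exact hr k)
  have hN : (1 : ℝ) ≤ (DS G).card := by
    exact_mod_cast (Finset.card_pos.mpr (DS_nonempty G))
  have hNlog : 0 ≤ Real.log (DS G).card := Real.log_nonneg hN
  have hG : 0 ≤ Gstar G p γ τ T₀ := by
    obtain ⟨s, hs⟩ := DS_nonempty G
    exact (abs_nonneg _).trans
      (Finset.le_sup' (fun s => |Real.log (gDS G p γ τ T₀ s)|) hs)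
  have hL : Real.log b ≤ Real.log (1 / ε) := by
    apply Real.log_le_log hb0
    rw [le_div_iff₀ hε]
    rw [le_div_iff₀ hb0] at hεb
    linarith
  rw [Real.log_div (by linarith) hb0.ne']
  have h5 : (b - A) * Real.log b ≤ (b - A) * Real.log (1 / ε) :=
    mul_le_mul_of_nonneg_left hL (by linarith)
  have h6 : 0 ≤ b * Real.log (DS G).card := by positivity
  have h7 : 0 ≤ b * Gstar G p γ τ T₀ := by positivity
  nlinarith
end
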